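/- arXiv:2402.14927 — 2 statements merged into one kernel-verified Lean document; each statement's English description precedes it below -/
import Mathlib

section
/- There exists an absolute constant c > 0 with the following property. For every positive integer k, the number of distinct functions of the form g_{G,k}, taken over all finite simple graphs G whose vertex set contains {1,…,k}, is at most 2^{c·k³}. -/
/-- The matching number of a graph: the maximum number of pairwise disjoint edges. -/
noncomputable def matchingNumber {V : Type} (G : SimpleGraph V) : ℕ :=
  sSup {n : ℕ | ∃ M : G.Subgraph, M.IsMatching ∧ M.edgeSet.ncard = n}

open Finset

/-- `W` can be partitioned into pairs of adjacent vertices. -/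
inductive Matchable {V : Type*} [DecidableEq V] (H : SimpleGraph V) : Finset V → Prop
  | empty : Matchable H ∅
  | insert_pair {a b : V} {W : Finset V} (ha : a ∉ W) (hb : b ∉ W) (hab : H.Adj a b)
      (hW : Matchable H W) : Matchable H (insert a (insert b W))

/-- The principal submatrix of `A` on `W` is nonsingular. -/
def PrincipalNonsing {V : Type*} [Fintype V] (A : Matrix V V ℝ) (W : Finset V) : Prop :=
  ∀ x : V → ℝ, (∀ v ∉ W, x v = 0) → (∀ v ∈ W, A.mulVec x v = 0) → x = 0

/-- The matrix `A` with the rows outside `W` replaced by those of the identity. -/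
def rowMix {V R : Type*} [DecidableEq V] [Zero R] [One R] (A : Matrix V V R) (W : Finset V) :
    Matrix V V R :=
  Matrix.of fun i j => if i ∈ W then A i j else (1 : Matrix V V R) i j

section LinearAlgebra

theorem dotProduct_mulVec_of_skew {V : Type*} [Fintype V] {A : Matrix V V ℝ}
    (hA : A.transpose = -A) (x y : V → ℝ) :
    x ⬝ᵥ A.mulVec y = -(y ⬝ᵥ A.mulVec x) := by
  rw [Matrix.dotProduct_mulVec, ← Matrix.mulVec_transpose, hA, Matrix.neg_mulVec,
    neg_dotProduct, dotProduct_comm]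

variable {V : Type*} [Fintype V] [DecidableEq V]

theorem rowMix_mulVec (A : Matrix V V ℝ) (W : Finset V) (x : V → ℝ) (v : V) :
    (rowMix A W).mulVec x v = if v ∈ W then A.mulVec x v else x v := by
  split_ifs with h
  · simp [rowMix, Matrix.mulVec, dotProduct, h]
  · simp [rowMix, Matrix.mulVec, dotProduct, h, Matrix.one_apply]

theorem principalNonsing_iff_det_ne_zero (A : Matrix V V ℝ) (W : Finset V) :
    PrincipalNonsing A W ↔ (rowMix A W).det ≠ 0 := by
  rw [ne_eq, ← Matrix.exists_mulVec_eq_zero_iff]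
  push Not
  constructor
  · intro h x hx h0
    refine hx (h x (fun v hv => ?_) fun v hv => ?_)
    · simpa [rowMix_mulVec, hv] using congrFun h0 v
    · simpa [rowMix_mulVec, hv] using congrFun h0 v
  · intro h x hx hA
    by_contra hne
    refine h x hne (funext fun v => ?_)
    rw [rowMix_mulVec]
    split_ifs with hv
    · exact hA v hv
    · exact hx v hv

/-- Principal pivot transform. -/
theorem PrincipalNonsing.exists_pivot {A : Matrix V V ℝ} {X : Finset V}
    (hX : PrincipalNonsing A X) :
    ∃ P : Matrix V V ℝ, ∀ T, PrincipalNonsing A (symmDiff X T) ↔ PrincipalNonsing P T := by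
  rw [principalNonsing_iff_det_ne_zero] at hX
  have hu : IsUnit (rowMix A X).det := hX.isUnit
  let P := rowMix A Xᶜ * (rowMix A X)⁻¹
  have key : ∀ T, rowMix A (symmDiff X T) = rowMix P T * rowMix A X := by
    intro T
    apply Matrix.toLin'.injective
    ext1 j
    ext1
    ext v
    simp only [LinearMap.comp_apply, Matrix.toLin'_apply, ← Matrix.mulVec_mulVec]
    generalize (LinearMap.single ℝ (fun _ => ℝ) j) 1 = x
    rw [rowMix_mulVec, rowMix_mulVec, Matrix.mulVec_mulVec,
      Matrix.nonsing_inv_mul_cancel_right _ _ hu, rowMix_mulVec, rowMix_mulVec]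
    by_cases h1 : v ∈ X <;> by_cases h2 : v ∈ T <;> simp [Finset.mem_symmDiff, h1, h2]
  refine ⟨P, fun T => ?_⟩
  rw [principalNonsing_iff_det_ne_zero, principalNonsing_iff_det_ne_zero, key, Matrix.det_mul]
  simp [hX]

theorem principalNonsing_map {R : Type*} [Fintype R] (P : Matrix V V ℝ)
    (f : R ↪ V) (T : Finset R) :
    PrincipalNonsing P (T.map f) ↔ PrincipalNonsing (P.submatrix f f) T := by
  have sum_eq : ∀ (x : V → ℝ), (∀ v ∉ T.map f, x v = 0) → ∀ v,
      P.mulVec x v = ∑ j, P v (f j) * x (f j) := by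
    intro x hx v
    simp only [Matrix.mulVec, dotProduct]
    rw [← Finset.sum_map univ f (fun w => P v w * x w)]
    symm
    apply Finset.sum_subset (subset_univ _)
    intro w _ hw
    rw [hx w, mul_zero]
    intro h
    exact hw (Finset.map_subset_map.2 (subset_univ T) h)
  constructor
  · intro h y hy hP
    have hext : ∀ r, Function.extend f y 0 (f r) = y r := fun r => f.injective.extend_apply _ _ _
    have hsupp : ∀ v ∉ T.map f, Function.extend f y 0 v = 0 := by
      intro v hv
      by_cases hr : ∃ r, f r = v
      · obtain ⟨r, rfl⟩ := hr
        rw [hext]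
        exact hy r fun h => hv (mem_map_of_mem f h)
      · rw [Function.extend_apply' _ _ _ hr]; rfl
    have h0 := h (Function.extend f y 0) hsupp (by
      intro v hv
      obtain ⟨r, hr, rfl⟩ := mem_map.1 hv
      rw [sum_eq _ hsupp]
      simpa [hext, Matrix.mulVec, dotProduct] using hP r hr)
    funext r
    rw [← hext, h0]; rfl
  · intro h x hx hP
    have h0 := h (fun r => x (f r)) (fun r hr => hx _ (by simpa using hr)) (by
      intro r hr
      have := hP (f r) (mem_map_of_mem f hr)
      rw [sum_eq x hx] at this
      simpa [Matrix.mulVec, dotProduct] using this)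
    funext v
    by_cases hv : v ∈ T.map f
    · obtain ⟨r, -, rfl⟩ := mem_map.1 hv
      exact congrFun h0 r
    · exact hx v hv

theorem PrincipalNonsing.exists_erase_pair {A : Matrix V V ℝ} (hA : A.transpose = -A)
    {W : Finset V} (hW : PrincipalNonsing A W) {i : V} (hi : i ∈ W) :
    ∃ j ∈ W, j ≠ i ∧ A i j ≠ 0 ∧ PrincipalNonsing A ((W.erase i).erase j) := by
  have hu : IsUnit (rowMix A W).det := ((principalNonsing_iff_det_ne_zero A W).1 hW).isUnit
  obtain ⟨u, hu⟩ : ∃ u, (rowMix A W).mulVec u = Pi.single i 1 :=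
    ⟨(rowMix A W)⁻¹.mulVec (Pi.single i 1), by
      rw [Matrix.mulVec_mulVec, Matrix.mul_nonsing_inv _ hu, Matrix.one_mulVec]⟩
  have hu0 : ∀ v ∉ W, u v = 0 := by
    intro v hv
    have := congrFun hu v
    rw [rowMix_mulVec, if_neg hv] at this
    rw [this, Pi.single_eq_of_ne]
    rintro rfl
    exact hv hi
  have hAu : ∀ v ∈ W, A.mulVec u v = (Pi.single i 1 : V → ℝ) v := by
    intro v hv
    have := congrFun hu v
    rwa [rowMix_mulVec, if_pos hv] at this
  have pair : ∀ z : V → ℝ, (∀ v ∉ W, z v = 0) → z ⬝ᵥ A.mulVec u = z i := by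
    intro z hz
    have : ∀ v, z v * A.mulVec u v = z v * (Pi.single i 1 : V → ℝ) v := by
      intro v
      by_cases hv : v ∈ W
      · rw [hAu v hv]
      · rw [hz v hv, zero_mul, zero_mul]
    simp [dotProduct, this, Pi.single_apply]
  have hui : u i = 0 := by
    have h1 := dotProduct_mulVec_of_skew hA u u
    rw [pair u hu0] at h1
    linarith
  obtain ⟨j, -, hj⟩ : ∃ j ∈ univ, A i j * u j ≠ 0 := by
    apply Finset.exists_ne_zero_of_sum_ne_zero
    have := hAu i hi
    simp only [Matrix.mulVec, dotProduct, Pi.single_eq_same] at this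
    simp [this]
  have hAj := left_ne_zero_of_mul hj
  have huj := right_ne_zero_of_mul hj
  have hjW : j ∈ W := by
    by_contra h
    exact huj (hu0 j h)
  have hji : j ≠ i := by
    rintro rfl
    exact huj hui
  refine ⟨j, hjW, hji, hAj, fun z hz hAz => ?_⟩
  have hzi : z i = 0 := hz i (by simp)
  have hzj : z j = 0 := hz j (by simp)
  have hzW : ∀ v ∉ W, z v = 0 := fun v hv => hz v (by simp [hv])
  have hAz' : ∀ v ∈ W, v ≠ i → v ≠ j → A.mulVec z v = 0 := fun v hv h1 h2 =>
    hAz v (by simp [hv, h1, h2])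
  have hAzj : A.mulVec z j = 0 := by
    have h1 := dotProduct_mulVec_of_skew hA u z
    rw [pair z hzW, hzi, neg_zero, dotProduct, Finset.sum_eq_single j] at h1
    · exact (mul_eq_zero.1 h1).resolve_left huj
    · intro v _ hvj
      by_cases hvi : v = i
      · rw [hvi, hui, zero_mul]
      by_cases hv : v ∈ W
      · rw [hAz' v hv hvi hvj, mul_zero]
      · rw [hu0 v hv, zero_mul]
    · simp
  have hzu : z - A.mulVec z i • u = 0 := by
    apply hW
    · intro v hv
      simp [hzW v hv, hu0 v hv]
    · intro v hv
      rw [Matrix.mulVec_sub, Matrix.mulVec_smul, Pi.sub_apply, Pi.smul_apply, hAu v hv]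
      by_cases hvi : v = i
      · subst hvi; simp
      · by_cases hvj : v = j
        · subst hvj; simp [hvi, hAzj]
        · simp [hvi, hAz' v hv hvi hvj]
  have hc : A.mulVec z i = 0 := by
    have := congrFun hzu j
    simp only [Pi.sub_apply, hzj, Pi.smul_apply, smul_eq_mul, zero_sub, Pi.zero_apply,
      neg_eq_zero] at this
    exact (mul_eq_zero.1 this).resolve_right huj
  simpa [hc] using hzu

end LinearAlgebra

section Tutte

/-- The skew-symmetric matrix supported on `H` with weights `x`. -/
def tutteMatrix {V R : Type*} [Ring R] (H : SimpleGraph V) [DecidableRel H.Adj] (x : V × V → R) :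
    Matrix V V R :=
  Matrix.of fun i j => if H.Adj i j then x (i, j) - x (j, i) else 0

theorem transpose_tutteMatrix {V : Type*} (H : SimpleGraph V) [DecidableRel H.Adj] (x : V × V → ℝ) :
    (tutteMatrix H x).transpose = -tutteMatrix H x := by
  ext i j
  simp only [tutteMatrix, Matrix.transpose_apply, Matrix.of_apply, Matrix.neg_apply,
    H.adj_comm j i]
  split_ifs <;> simp

variable {V : Type*} [DecidableEq V] {H : SimpleGraph V}

theorem matchable_of_principalNonsing [Fintype V] {A : Matrix V V ℝ} (hA : A.transpose = -A)
    (hH : ∀ i j, A i j ≠ 0 → H.Adj i j) (W : Finset V) (hW : PrincipalNonsing A W) :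
    Matchable H W := by
  induction W using Finset.strongInduction with
  | H W ih =>
    obtain rfl | ⟨i, hi⟩ := W.eq_empty_or_nonempty
    · exact .empty
    obtain ⟨j, hj, hji, hAj, hW'⟩ := hW.exists_erase_pair hA hi
    have hsub : (W.erase i).erase j ⊂ W :=
      (Finset.erase_subset _ _).trans_ssubset (Finset.erase_ssubset hi)
    have h := Matchable.insert_pair (a := i) (b := j) (by simp) (by simp) (hH i j hAj)
      (ih _ hsub hW')
    rwa [Finset.insert_erase (by simp [hj, hji]), Finset.insert_erase hi] at h

theorem Matchable.exists_involution {W : Finset V} (hW : Matchable H W) :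
    ∃ f : V → V, ∀ v ∈ W, f v ∈ W ∧ H.Adj v (f v) ∧ f (f v) = v := by
  induction hW with
  | empty => exact ⟨id, by simp⟩
  | @insert_pair a b W ha hb hab _ ih =>
    obtain ⟨f, hf⟩ := ih
    have hne := hab.ne
    refine ⟨fun v => if v = a then b else if v = b then a else f v, fun v hv => ?_⟩
    by_cases hva : v = a
    · subst hva
      simp [hne.symm, hab]
    by_cases hvb : v = b
    · subst hvb
      simp [hne.symm, hab.symm]
    have hvW : v ∈ W := by simpa [hva, hvb] using hv
    obtain ⟨h1, h2, h3⟩ := hf v hvW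
    have h4 : f v ≠ a := fun h => ha (h ▸ h1)
    have h5 : f v ≠ b := fun h => hb (h ▸ h1)
    simp [hva, hvb, h1, h2, h3, h4, h5]

theorem Matchable.exists_weights [Fintype V] [DecidableRel H.Adj] {W : Finset V}
    (hW : Matchable H W) : ∃ x, PrincipalNonsing (tutteMatrix H x) W := by
  obtain ⟨f, hf⟩ := hW.exists_involution
  let r : V → ℝ := fun v => (Fintype.equivFin V v : ℕ)
  have hr : Function.Injective r := fun a b h =>
    (Fintype.equivFin V).injective (Fin.ext (Nat.cast_injective h))
  refine ⟨fun p => if p.1 ∈ W ∧ p.2 = f p.1 then r p.1 else 0, fun y hy hA => ?_⟩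
  funext v
  by_cases hv : v ∈ W
  swap
  · exact hy v hv
  obtain ⟨h1, h2, h3⟩ := hf v hv
  have h := hA (f v) h1
  simp only [Matrix.mulVec, dotProduct] at h
  rw [Finset.sum_eq_single v] at h
  · have hne : r (f v) - r v ≠ 0 := sub_ne_zero.2 fun e => h2.ne (hr e).symm
    simpa [tutteMatrix, h2.symm, h1, h3, hv, hne] using h
  · intro w _ hwv
    have e1 : w ≠ f (f v) := by rwa [h3]
    have e2 : ¬ (w ∈ W ∧ f v = f w) := by
      rintro ⟨hw, e⟩
      exact e1 (by rw [e, (hf w hw).2.2])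
    simp [tutteMatrix, e1, e2]
  · simp

theorem exists_matrix_matchable_iff [Fintype V] (H : SimpleGraph V) :
    ∃ A : Matrix V V ℝ, ∀ W, PrincipalNonsing A W ↔ Matchable H W := by
  classical
  let Q : Finset V → MvPolynomial (V × V) ℝ := fun W =>
    (rowMix (tutteMatrix H MvPolynomial.X) W).det
  have hQ : ∀ x W, MvPolynomial.eval x (Q W) = (rowMix (tutteMatrix H x) W).det := by
    intro x W
    simp only [Q, RingHom.map_det]
    congr 1
    ext i j
    by_cases hi : i ∈ W
    · by_cases h : H.Adj i j <;> simp [rowMix, tutteMatrix, hi, h]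
    · by_cases h : i = j
      · subst h; simp [rowMix, hi]
      · simp [rowMix, hi, h]
  have hprod : ∏ W with Matchable H W, Q W ≠ 0 := by
    rw [Finset.prod_ne_zero_iff]
    intro W hW h0
    obtain ⟨x, hx⟩ := (Finset.mem_filter.1 hW).2.exists_weights
    rw [principalNonsing_iff_det_ne_zero, ← hQ, h0, map_zero] at hx
    exact hx rfl
  obtain ⟨x, hx⟩ : ∃ x, MvPolynomial.eval x (∏ W with Matchable H W, Q W) ≠ 0 := by
    by_contra! h
    exact hprod (MvPolynomial.funext fun x => by rw [h x, map_zero])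
  rw [map_prod, Finset.prod_ne_zero_iff] at hx
  refine ⟨tutteMatrix H x, fun W => ⟨?_, fun hW => ?_⟩⟩
  · apply matchable_of_principalNonsing (transpose_tutteMatrix H x)
    intro i j hij
    by_contra h
    exact hij (by simp [tutteMatrix, h])
  · rw [principalNonsing_iff_det_ne_zero, ← hQ]
    exact hx W (by simpa using hW)

end Tutte

section ZeroPatterns

theorem mem_span_monomials_of_totalDegree_le {σ : Type*} [Fintype σ] {p : MvPolynomial σ ℝ} {E : ℕ}
    (hp : p.totalDegree ≤ E) :
    p ∈ Submodule.span ℝ (Set.range fun e : σ → Fin (E + 1) =>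
      MvPolynomial.monomial (Finsupp.equivFunOnFinite.symm fun s => (e s : ℕ)) (1 : ℝ)) := by
  rw [p.as_sum]
  refine Submodule.sum_mem _ fun d hd => ?_
  have hle : ∀ s, d s < E + 1 := fun s => by
    have h1 := (MvPolynomial.le_totalDegree hd).trans hp
    have h2 := Finsupp.le_degree s d
    rw [Finsupp.degree_eq_sum] at h2
    rw [Finsupp.sum_fintype _ _ (fun _ => rfl)] at h1
    omega
  have : MvPolynomial.monomial d (p.coeff d) = p.coeff d • MvPolynomial.monomial d (1 : ℝ) := by
    rw [MvPolynomial.smul_monomial, smul_eq_mul, mul_one]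
  rw [this]
  refine Submodule.smul_mem _ _ (Submodule.subset_span ⟨fun s => ⟨d s, hle s⟩, ?_⟩)
  ext s
  simp

/-- The Rónyai–Babai–Ganapathy bound on the number of zero patterns. -/
theorem ncard_zeroPatterns_le {σ ι : Type*} [Fintype σ] [Fintype ι]
    (f : ι → MvPolynomial σ ℝ) {D : ℕ} (hf : ∀ i, (f i).totalDegree ≤ D) :
    {Z : Finset ι | ∃ x, ∀ i, i ∈ Z ↔ MvPolynomial.eval x (f i) ≠ 0}.ncard ≤
      (Fintype.card ι * D + 1) ^ Fintype.card σ := by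
  classical
  set S := {Z : Finset ι | ∃ x, ∀ i, i ∈ Z ↔ MvPolynomial.eval x (f i) ≠ 0}
  choose x hx using fun Z : S => Z.2
  let p : S → MvPolynomial σ ℝ := fun Z => ∏ i ∈ Z.1, f i
  have hp : ∀ Z Z' : S, MvPolynomial.eval (x Z) (p Z') ≠ 0 ↔ Z'.1 ⊆ Z.1 := by
    intro Z Z'
    simp only [p, map_prod, Finset.prod_ne_zero_iff, Finset.subset_iff, hx]
  have hdeg : ∀ Z, (p Z).totalDegree ≤ Fintype.card ι * D := by
    intro Z
    calc (p Z).totalDegree ≤ ∑ i ∈ Z.1, (f i).totalDegree := MvPolynomial.totalDegree_finsetProd _ _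
      _ ≤ ∑ i ∈ Z.1, D := Finset.sum_le_sum fun i _ => hf i
      _ ≤ Fintype.card ι * D := by
        rw [Finset.sum_const, smul_eq_mul]
        exact Nat.mul_le_mul_right _ (Finset.card_le_univ _)
  have hli : LinearIndependent ℝ p := by
    rw [Fintype.linearIndependent_iff]
    intro c hc
    by_contra! hne
    obtain ⟨Z, hZ, hmin⟩ := (univ.filter fun Z => c Z ≠ 0).exists_min_image (fun Z => #Z.1)
      (by obtain ⟨Z, hZ⟩ := hne; exact ⟨Z, by simpa using hZ⟩)
    have h := congrArg (MvPolynomial.eval (x Z)) hc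
    rw [map_sum, Finset.sum_eq_single Z] at h
    · have h1 := (hp Z Z).2 subset_rfl
      have h2 : c Z ≠ 0 := by simpa using hZ
      simp [h1, h2] at h
    · intro Z' _ hZ'
      rw [MvPolynomial.smul_eval]
      by_cases hcz : c Z' = 0
      · rw [hcz, zero_mul]
      · have : ¬ Z'.1 ⊆ Z.1 := fun hsub => hZ' (Subtype.ext
          (Finset.eq_of_subset_of_card_le hsub (hmin Z' (by simpa using hcz))))
        rw [← hp, not_not] at this
        rw [this, mul_zero]
    · simp
  have h := linearIndependent_le_span' p hli _ (by
    rintro _ ⟨Z, rfl⟩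
    exact mem_span_monomials_of_totalDegree_le (hdeg Z))
  rw [Cardinal.mk_fintype, Nat.cast_le] at h
  calc S.ncard = Fintype.card S := by rw [← Nat.card_coe_set_eq, Nat.card_eq_fintype_card]
    _ ≤ _ := h
    _ ≤ Fintype.card (σ → Fin (Fintype.card ι * D + 1)) := Fintype.card_range_le _
    _ = _ := by simp

theorem totalDegree_det_le {R : Type*} [Fintype R] [DecidableEq R] {σ : Type*}
    (M : Matrix R R (MvPolynomial σ ℝ)) (hM : ∀ i j, (M i j).totalDegree ≤ 1) :
    M.det.totalDegree ≤ Fintype.card R := by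
  rw [Matrix.det_apply]
  refine MvPolynomial.totalDegree_finsetSum_le fun s _ => ?_
  refine (MvPolynomial.totalDegree_smul_le _ _).trans ?_
  refine (MvPolynomial.totalDegree_finsetProd _ _).trans ?_
  refine (Finset.sum_le_sum fun i _ => hM _ _).trans ?_
  simp

/-- The families of index sets of nonsingular principal submatrices of real matrices. -/
def nonsingPatterns (R : Type*) [Fintype R] : Set (Finset (Finset R)) :=
  {Z | ∃ C : Matrix R R ℝ, ∀ T, T ∈ Z ↔ PrincipalNonsing C T}

theorem ncard_nonsingPatterns_le (R : Type*) [Fintype R] [DecidableEq R] :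
    (nonsingPatterns R).ncard ≤
      (2 ^ Fintype.card R * Fintype.card R + 1) ^ (Fintype.card R * Fintype.card R) := by
  let f : Finset R → MvPolynomial (R × R) ℝ := fun T =>
    (rowMix (Matrix.of fun i j => MvPolynomial.X (i, j)) T).det
  have hf : ∀ C : Matrix R R ℝ, ∀ T,
      MvPolynomial.eval (fun q => C q.1 q.2) (f T) = (rowMix C T).det := by
    intro C T
    simp only [f, RingHom.map_det]
    congr 1
    ext i j
    by_cases hi : i ∈ T
    · simp [rowMix, hi]
    · by_cases h : i = j
      · subst h; simp [rowMix, hi]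
      · simp [rowMix, hi, h]
  have h := ncard_zeroPatterns_le f (D := Fintype.card R) fun T => totalDegree_det_le _ (by
    intro i j
    by_cases hi : i ∈ T
    · simp [rowMix, hi, MvPolynomial.totalDegree_X]
    · by_cases h : i = j
      · subst h; simp [rowMix, hi]
      · simp [rowMix, hi, h])
  rw [Fintype.card_finset, Fintype.card_prod] at h
  refine (Set.ncard_le_ncard ?_ (Set.toFinite _)).trans h
  rintro Z ⟨C, hC⟩
  exact ⟨fun q => C q.1 q.2, fun T => by rw [hC, hf, principalNonsing_iff_det_ne_zero]⟩

end ZeroPatterns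

section MatchingNumber

theorem SimpleGraph.Subgraph.IsMatching.ncard_verts {V : Type*} [Fintype V] {G : SimpleGraph V}
    {M : G.Subgraph}
    (hM : M.IsMatching) : M.verts.ncard = 2 * M.edgeSet.ncard := by
  classical
  have h := M.spanningCoe.sum_degrees_eq_twice_card_edges
  rw [← SimpleGraph.Subgraph.edgeSet_spanningCoe, ← SimpleGraph.coe_edgeFinset, Set.ncard_coe_finset,
    ← h]
  simp only [SimpleGraph.Subgraph.degree_spanningCoe]
  have hdeg : ∀ v, M.degree v = if v ∈ M.verts then 1 else 0 := by
    intro v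
    split_ifs with hv
    · exact SimpleGraph.Subgraph.isMatching_iff_forall_degree.1 hM v hv
    · exact SimpleGraph.Subgraph.degree_of_notMem_verts hv
  simp only [hdeg, Finset.sum_boole, Nat.cast_id]
  rw [Set.ncard_eq_toFinset_card']
  congr 1
  ext v
  simp

variable {V : Type*} [DecidableEq V] {G : SimpleGraph V}

theorem matchable_of_involution (f : V → V) (W : Finset V)
    (hf : ∀ v ∈ W, f v ∈ W ∧ G.Adj v (f v) ∧ f (f v) = v) : Matchable G W := by
  induction W using Finset.strongInduction with
  | H W ih =>
    obtain rfl | ⟨i, hi⟩ := W.eq_empty_or_nonempty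
    · exact .empty
    obtain ⟨h1, h2, h3⟩ := hf i hi
    have hsub : (W.erase i).erase (f i) ⊂ W :=
      (Finset.erase_subset _ _).trans_ssubset (Finset.erase_ssubset hi)
    have h := Matchable.insert_pair (a := i) (b := f i) (by simp) (by simp) h2
      (ih _ hsub fun v hv => by
        simp only [Finset.mem_erase] at hv ⊢
        obtain ⟨hv1, hv2, hv3⟩ := hv
        obtain ⟨k1, k2, k3⟩ := hf v hv3
        refine ⟨⟨fun e => hv2 ?_, fun e => hv1 ?_, k1⟩, k2, k3⟩
        · rw [← k3, e, h3]
        · rw [← k3, e])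
    rwa [Finset.insert_erase (by simp [h1, h2.ne']), Finset.insert_erase hi] at h

theorem SimpleGraph.Subgraph.IsMatching.matchable [Fintype V] {M : G.Subgraph}
    (hM : M.IsMatching) : ∃ W, Matchable G W ∧ #W = 2 * M.edgeSet.ncard := by
  classical
  refine ⟨M.verts.toFinset, ?_, by rw [← hM.ncard_verts, Set.ncard_eq_toFinset_card']⟩
  choose! f hf using fun v hv => (hM (v := v) hv).exists
  refine matchable_of_involution f _ fun v hv => ?_
  rw [Set.mem_toFinset] at hv ⊢
  have h1 := hf v hv
  have h2 := M.edge_vert h1.symm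
  exact ⟨h2, h1.adj_sub, hM.eq_of_adj_left (hf _ h2) h1.symm⟩

theorem Matchable.exists_isMatching {W : Finset V} (hW : Matchable G W) :
    ∃ M : G.Subgraph, M.IsMatching ∧ M.verts = W := by
  induction hW with
  | empty => exact ⟨⊥, fun v hv => hv.elim, by simp⟩
  | @insert_pair a b W ha hb hab _ ih =>
    obtain ⟨M, hM, hMW⟩ := ih
    refine ⟨G.subgraphOfAdj hab ⊔ M, (SimpleGraph.Subgraph.IsMatching.subgraphOfAdj hab).sup hM ?_,
      ?_⟩
    · rw [hM.support_eq_verts,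
        (SimpleGraph.Subgraph.IsMatching.subgraphOfAdj hab).support_eq_verts, hMW]
      simp [ha, hb]
    · ext v
      simp [hMW, or_assoc]

theorem exists_matchable_card_eq_matchingNumber {V : Type} [Fintype V] [DecidableEq V]
    (G : SimpleGraph V) :
    (∃ W, Matchable G W ∧ #W = 2 * matchingNumber G) ∧
      ∀ W, Matchable G W → #W ≤ 2 * matchingNumber G := by
  set s := {n : ℕ | ∃ M : G.Subgraph, M.IsMatching ∧ M.edgeSet.ncard = n}
  have hne : s.Nonempty := ⟨_, ⊥, fun v hv => hv.elim, rfl⟩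
  have hbdd : BddAbove s := by
    refine ⟨Fintype.card V, ?_⟩
    rintro n ⟨M, hM, rfl⟩
    obtain ⟨W, -, hW⟩ := hM.matchable
    have := Finset.card_le_univ W
    omega
  constructor
  · obtain ⟨M, hM, hn⟩ := Nat.sSup_mem hne hbdd
    obtain ⟨W, hW, hc⟩ := hM.matchable
    exact ⟨W, hW, by rw [hc, hn]; rfl⟩
  · intro W hW
    obtain ⟨M, hM, hMW⟩ := hW.exists_isMatching
    have h1 := hM.ncard_verts
    rw [hMW, Set.ncard_coe_finset] at h1
    have h2 : M.edgeSet.ncard ≤ matchingNumber G := le_csSup hbdd ⟨M, hM, rfl⟩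
    omega

theorem Matchable.map {V' : Type*} [DecidableEq V'] {G' : SimpleGraph V'} (f : V ↪ V')
    {W : Finset V} (hf : ∀ v ∈ W, ∀ w ∈ W, G.Adj v w → G'.Adj (f v) (f w)) (hW : Matchable G W) :
    Matchable G' (W.map f) := by
  induction hW with
  | empty => exact .empty
  | @insert_pair a b W ha hb hab _ ih =>
    rw [Finset.map_insert, Finset.map_insert]
    exact .insert_pair (by simpa using ha) (by simpa using hb) (hf _ (by simp) _ (by simp) hab)
      (ih fun v hv w hw => hf v (by simp [hv]) w (by simp [hw]))

theorem Matchable.subtype {W : Finset V} (s : Set V) [DecidablePred (· ∈ s)]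
    (hW : Matchable G W) (hs : ∀ v ∈ W, v ∈ s) :
    Matchable (G.induce s) (W.subtype (· ∈ s)) := by
  obtain ⟨f, hf⟩ := hW.exists_involution
  refine matchable_of_involution
    (fun v : s => if h : f v ∈ s then (⟨f v, h⟩ : s) else v) _ fun v hv => ?_
  obtain ⟨h1, h2, h3⟩ := hf v (by simpa using hv)
  simp [hs _ h1, h1, h2, h3]

/-- The matching number of an induced subgraph in terms of matchable sets. -/
theorem matchingNumber_induce {V : Type} [Fintype V] [DecidableEq V]
    (G : SimpleGraph V) (U : Finset V) (s : Set V) (hs : ∀ v, v ∈ s ↔ v ∈ U) :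
    (∃ W ⊆ U, Matchable G W ∧ #W = 2 * matchingNumber (G.induce s)) ∧
      ∀ W ⊆ U, Matchable G W → #W ≤ 2 * matchingNumber (G.induce s) := by
  classical
  obtain ⟨⟨W, hW, hc⟩, h⟩ := exists_matchable_card_eq_matchingNumber (G.induce s)
  constructor
  · refine ⟨W.map (Function.Embedding.subtype _), ?_, hW.map _ fun _ _ _ _ h => h, by simpa using hc⟩
    intro v hv
    obtain ⟨w, -, rfl⟩ := Finset.mem_map.1 hv
    exact (hs _).1 w.2
  · intro W hWU hW
    have hWs : ∀ v ∈ W, v ∈ s := fun v hv => (hs v).2 (hWU hv)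
    have := h _ (hW.subtype s hWs)
    rwa [Finset.card_subtype, Finset.filter_true_of_mem hWs] at this

end MatchingNumber

section Universal

variable {V : Type*} [DecidableEq V] {G : SimpleGraph V}

/-- The graph `G` together with new vertices adjacent to everything. -/
def addUniversal (G : SimpleGraph V) (Y : Type*) : SimpleGraph (V ⊕ Y) where
  Adj
    | .inl a, .inl b => G.Adj a b
    | u, v => u ≠ v
  symm := ⟨by
    rintro (a | a) (b | b) h
    · exact SimpleGraph.Adj.symm h
    all_goals exact Ne.symm h⟩
  loopless := ⟨by
    rintro (a | a) h
    · exact G.loopless.irrefl a h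
    · exact h rfl⟩

variable {Y : Type*} [DecidableEq Y]

theorem Matchable.even_card {W : Finset V} (hW : Matchable G W) : Even #W := by
  induction hW with
  | empty => simp
  | insert_pair ha hb hab _ ih =>
    rw [card_insert_of_notMem (by simp [ha, hab.ne]), card_insert_of_notMem hb, add_assoc]
    exact ih.add even_two

theorem Matchable.exists_of_addUniversal {W : Finset (V ⊕ Y)}
    (hW : Matchable (addUniversal G Y) W) :
    ∃ W' ⊆ W.toLeft, Matchable G W' ∧ #W.toLeft ≤ #W' + #W.toRight := by
  induction hW with
  | empty => exact ⟨∅, by simp, .empty, by rfl⟩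
  | @insert_pair a b W ha hb hab _ ih =>
    obtain ⟨W', hsub, hW', hc⟩ := ih
    rcases a with a | a <;> rcases b with b | b
    · have ha' : a ∉ W' := fun h => ha (by simpa using hsub h)
      have hb' : b ∉ W' := fun h => hb (by simpa using hsub h)
      have hne : a ≠ b := G.ne_of_adj hab
      refine ⟨insert a (insert b W'), ?_, .insert_pair ha' hb' hab hW', ?_⟩
      · simpa using insert_subset_insert a (insert_subset_insert b hsub)
      · have h1 := card_insert_le a (insert b W.toLeft)
        have h2 := card_insert_le b W.toLeft
        rw [card_insert_of_notMem (by simp [ha', hne]), card_insert_of_notMem hb']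
        simp only [toLeft_insert_inl, toRight_insert_inl]
        omega
    · refine ⟨W', ?_, hW', ?_⟩
      · simpa using hsub.trans (subset_insert a _)
      · have h1 := card_insert_le a W.toLeft
        simp only [toLeft_insert_inl, toRight_insert_inl, toLeft_insert_inr, toRight_insert_inr]
        rw [card_insert_of_notMem (s := W.toRight) (by simpa using hb)]
        omega
    · refine ⟨W', ?_, hW', ?_⟩
      · simpa using hsub.trans (subset_insert b _)
      · have h1 := card_insert_le b W.toLeft
        simp only [toLeft_insert_inl, toRight_insert_inl, toLeft_insert_inr, toRight_insert_inr]
        rw [card_insert_of_notMem (s := W.toRight) (by simpa using ha)]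
        omega
    · refine ⟨W', by simpa using hsub, hW', ?_⟩
      have h1 := card_le_card (subset_insert b W.toRight)
      have h2 := card_le_card (subset_insert a (insert b W.toRight))
      simp only [toLeft_insert_inr, toRight_insert_inr]
      omega

theorem Matchable.addUniversal {W U : Finset V} {D : Finset Y} (hW : Matchable G W)
    (hUW : Disjoint U W) (hc : #U ≤ #D) (he : Even (#U + #D)) :
    Matchable (addUniversal G Y) ((U ∪ W).disjSum D) := by
  induction U using Finset.induction generalizing D with
  | empty =>
    rw [Finset.empty_union]
    simp only [card_empty, zero_add] at he
    clear hc hUW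
    induction D using Finset.strongInduction with
    | H D ih =>
      obtain rfl | ⟨i, hi⟩ := D.eq_empty_or_nonempty
      · have : W.disjSum (∅ : Finset Y) = W.map Function.Embedding.inl := by
          ext (v | v) <;> simp
        rw [this]
        exact hW.map _ fun _ _ _ _ h => h
      · have hpos : (D.erase i).Nonempty := by
          rw [← card_pos, card_erase_of_mem hi]
          have := card_pos.2 ⟨i, hi⟩
          obtain ⟨t, ht⟩ := he
          omega
        obtain ⟨j, hj⟩ := hpos
        have h := ih ((D.erase i).erase j)
          ((erase_subset _ _).trans_ssubset (erase_ssubset hi)) (by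
            rw [card_erase_of_mem hj, card_erase_of_mem hi]
            obtain ⟨t, ht⟩ := he
            exact ⟨t - 1, by omega⟩)
        have h' := Matchable.insert_pair (a := Sum.inr i) (b := Sum.inr j) (by simp) (by simp)
          (show (_root_.addUniversal G Y).Adj _ _ from by
            simpa [_root_.addUniversal] using (ne_of_mem_erase hj).symm) h
        convert h' using 1
        ext (v | v)
        · simp
        · by_cases h1 : v = i <;> by_cases h2 : v = j <;> simp_all
  | insert u U hu ih =>
    rw [card_insert_of_notMem hu] at hc he
    obtain ⟨d, hd⟩ : D.Nonempty := card_pos.1 (by omega)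
    rw [Finset.disjoint_insert_left] at hUW
    have h := ih (D := D.erase d) hUW.2 (by rw [card_erase_of_mem hd]; omega) (by
      rw [card_erase_of_mem hd]
      obtain ⟨t, ht⟩ := he
      exact ⟨t - 1, by omega⟩)
    have h' := Matchable.insert_pair (a := Sum.inl u) (b := Sum.inr d) (by simp [hu, hUW.1])
      (by simp) (show (_root_.addUniversal G Y).Adj _ _ from by simp [_root_.addUniversal]) h
    convert h' using 1
    ext (v | v)
    · simp
    · by_cases h1 : v = d <;> simp_all

theorem matchable_addUniversal_iff {U : Finset V} {D : Finset Y} {m : ℕ}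
    (hm : ∃ W ⊆ U, Matchable G W ∧ #W = 2 * m) (hmax : ∀ W ⊆ U, Matchable G W → #W ≤ 2 * m) :
    Matchable (addUniversal G Y) (U.disjSum D) ↔ #U ≤ 2 * m + #D ∧ Even (#U + #D) := by
  constructor
  · intro h
    obtain ⟨W', hsub, hW', hc⟩ := h.exists_of_addUniversal
    rw [toLeft_disjSum] at hsub
    rw [toLeft_disjSum, toRight_disjSum] at hc
    have := hmax W' hsub hW'
    exact ⟨by omega, by simpa using h.even_card⟩
  · rintro ⟨hle, t, ht⟩
    obtain ⟨W, hWU, hW, hc⟩ := hm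
    have h1 := card_sdiff_add_card_eq_card hWU
    have h := hW.addUniversal (U := U \ W) (D := D) sdiff_disjoint (by omega)
      ⟨t - m, by omega⟩
    rwa [sdiff_union_of_subset hWU] at h

theorem Matchable.exists_sdiff {W : Finset V} (hW : Matchable G W) (K : Finset V) :
    ∃ W' ⊆ W \ K, Matchable G W' ∧ #W ≤ #W' + 2 * #(W ∩ K) := by
  induction hW with
  | empty => exact ⟨∅, by simp, .empty, by simp⟩
  | @insert_pair a b W ha hb hab _ ih =>
    obtain ⟨W', hsub, hW', hc⟩ := ih
    have hcard : #(insert a (insert b W)) = #W + 2 := by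
      rw [card_insert_of_notMem (by simp [ha, hab.ne]), card_insert_of_notMem hb]
    have hmono : W \ K ⊆ insert a (insert b W) \ K :=
      sdiff_subset_sdiff ((subset_insert _ _).trans (subset_insert _ _)) subset_rfl
    by_cases hK : a ∈ K ∨ b ∈ K
    · refine ⟨W', hsub.trans hmono, hW', ?_⟩
      have : W ∩ K ⊂ insert a (insert b W) ∩ K := by
        refine Finset.ssubset_iff_subset_ne.2 ⟨inter_subset_inter
          ((subset_insert _ _).trans (subset_insert _ _)) subset_rfl, fun e => ?_⟩
        rcases hK with hK | hK
        · exact ha (mem_inter.1 (show a ∈ W ∩ K by rw [e]; simp [hK])).1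
        · exact hb (mem_inter.1 (show b ∈ W ∩ K by rw [e]; simp [hK])).1
      have := card_lt_card this
      omega
    · push Not at hK
      have ha' : a ∉ W' := fun h => ha (mem_sdiff.1 (hsub h)).1
      have hb' : b ∉ W' := fun h => hb (mem_sdiff.1 (hsub h)).1
      refine ⟨insert a (insert b W'), ?_, .insert_pair ha' hb' hab hW', ?_⟩
      · simp [insert_subset_iff, hK, hsub.trans hmono]
      · have := card_le_card (inter_subset_inter_right (u := K)
          ((subset_insert b W).trans (subset_insert a _)))
        rw [hcard, card_insert_of_notMem (by simp [ha', hab.ne]), card_insert_of_notMem hb']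
        omega

end Universal

section Counting

/-- The terminals toggled, starting from the reference set with `e` of the `2 * k` extra terminals,
to delete the vertices in `S` and keep the first `i` extra terminals. -/
def toggleSet (k e : ℕ) (S : Finset (Fin k)) (i : ℕ) : Finset (Fin k ⊕ Fin (2 * k)) :=
  Sᶜ.disjSum (symmDiff (univ.filter fun x : Fin (2 * k) => (x : ℕ) < e)
    (univ.filter fun x : Fin (2 * k) => (x : ℕ) < i))

/-- The pair `(e, Z)` encodes the function `g` : the pattern `Z` determines, for every `S`, the
deficiency `j S` up to a global shift. -/
def Encodes {k : ℕ} (q : Fin (k + 1) × Finset (Finset (Fin k ⊕ Fin (2 * k))))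
    (g : Finset (Fin k) → ℕ) : Prop :=
  ∃ j : Finset (Fin k) → ℕ, (∀ S, j S ≤ 2 * k) ∧ (∀ S, 2 * g S + j ∅ = #S + j S) ∧
    ∀ S, ∀ i ≤ 2 * k, toggleSet k q.1 S i ∈ q.2 ↔ j S ≤ i ∧ Even (i + j S)

theorem Encodes.unique {k : ℕ} {q : Fin (k + 1) × Finset (Finset (Fin k ⊕ Fin (2 * k)))}
    {g g' : Finset (Fin k) → ℕ} (h : Encodes q g) (h' : Encodes q g') : g = g' := by
  obtain ⟨j, hj, hg, hq⟩ := h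
  obtain ⟨j', hj', hg', hq'⟩ := h'
  have hjj : ∀ S, j S = j' S := fun S => by
    apply le_antisymm
    · exact ((hq S _ (hj' S)).1 ((hq' S _ (hj' S)).2 ⟨le_rfl, Even.add_self _⟩)).1
    · exact ((hq' S _ (hj S)).1 ((hq S _ (hj S)).2 ⟨le_rfl, Even.add_self _⟩)).1
  funext S
  have h1 := hg S
  have h2 := hg' S
  rw [hjj, hjj] at h1
  omega

theorem exists_encodes {n k : ℕ} (hkn : k ≤ n) (G : SimpleGraph (Fin n)) :
    ∃ q : Fin (k + 1) × Finset (Finset (Fin k ⊕ Fin (2 * k))), q.2 ∈ nonsingPatterns _ ∧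
      Encodes q fun S : Finset (Fin k) => matchingNumber G -
        matchingNumber (G.induce {v : Fin n | v ∉ S.image (Fin.castLE hkn)}) := by
  classical
  let ν : Finset (Fin k) → ℕ := fun S =>
    matchingNumber (G.induce {v : Fin n | v ∉ S.image (Fin.castLE hkn)})
  let U : Finset (Fin k) → Finset (Fin n) := fun S => (S.image (Fin.castLE hkn))ᶜ
  have hU : ∀ S, #(U S) + #S = n := fun S => by
    have := card_compl_add_card (S.image (Fin.castLE hkn))
    rwa [card_image_of_injective _ (Fin.castLE_injective hkn), Fintype.card_fin] at this
  have hνU : ∀ S, (∃ W ⊆ U S, Matchable G W ∧ #W = 2 * ν S) ∧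
      ∀ W ⊆ U S, Matchable G W → #W ≤ 2 * ν S := fun S =>
    matchingNumber_induce G (U S) _ (by simp [U])
  have hcard : ∀ S, 2 * ν S ≤ #(U S) := fun S => by
    obtain ⟨W, hWU, -, hc⟩ := (hνU S).1
    exact hc ▸ card_le_card hWU
  have hanti : ∀ S S', S ⊆ S' → ν S' ≤ ν S := fun S S' hS => by
    obtain ⟨W, hWU, hW, hc⟩ := (hνU S').1
    have := (hνU S).2 W (hWU.trans (compl_subset_compl.2 (image_subset_image hS))) hW
    omega
  have hνG : matchingNumber G = ν ∅ := by
    obtain ⟨⟨W, hW, hc⟩, hmax⟩ := exists_matchable_card_eq_matchingNumber G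
    obtain ⟨W', -, hW', hc'⟩ := (hνU ∅).1
    have h1 := (hνU ∅).2 W (by simp [U]) hW
    have h2 := hmax W' hW'
    omega
  have hlow : ∀ S, ν S + #S ≤ ν univ + k := fun S => by
    obtain ⟨W, hWU, hW, hc⟩ := (hνU S).1
    obtain ⟨W', hsub, hW', hc'⟩ := hW.exists_sdiff (univ.image (Fin.castLE hkn))
    have h1 := (hνU univ).2 W' (fun v hv => mem_compl.2 (mem_sdiff.1 (hsub hv)).2) hW'
    have h2 : #(W ∩ univ.image (Fin.castLE hkn)) ≤ #(Sᶜ.image (Fin.castLE hkn)) := by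
      refine card_le_card fun v hv => ?_
      obtain ⟨hv1, hv2⟩ := mem_inter.1 hv
      obtain ⟨s, -, rfl⟩ := mem_image.1 hv2
      have h3 := mem_compl.1 (hWU hv1)
      exact mem_image_of_mem _ (mem_compl.2 fun hs => h3 (mem_image_of_mem _ hs))
    rw [card_image_of_injective _ (Fin.castLE_injective hkn)] at h2
    have h4 := card_compl_add_card S
    rw [Fintype.card_fin] at h4
    omega
  have hUu := hU univ
  rw [card_univ, Fintype.card_fin] at hUu
  have hcu := hcard univ
  -- the deficiency of the graph without terminals, and the first extra terminal
  set d₀ := #(U univ) - 2 * ν univ with hd₀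
  set o := d₀ - k with ho
  set e := d₀ - o with he
  have hek : e < k + 1 := by omega
  let N := n + 2 * k
  let first : ℕ → Finset (Fin N) := fun d => univ.filter fun y => (y : ℕ) < d
  have hfirst : ∀ d ≤ N, #(first d) = d := fun d hd => by
    simp [first, Fin.card_filter_val_lt, hd]
  obtain ⟨A, hA⟩ := exists_matrix_matchable_iff (addUniversal G (Fin N))
  have hWA : ∀ S, ∀ d ≤ N, PrincipalNonsing A ((U S).disjSum (first d)) ↔
      #(U S) ≤ 2 * ν S + d ∧ Even (#(U S) + d) := fun S d hd => by
    rw [hA, matchable_addUniversal_iff (hνU S).1 (hνU S).2, hfirst d hd]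
  have hX : PrincipalNonsing A ((U univ).disjSum (first d₀)) :=
    (hWA univ d₀ (by omega)).2 ⟨by omega, #(U univ) - ν univ, by omega⟩
  obtain ⟨P, hP⟩ := hX.exists_pivot
  let ι : Fin k ⊕ Fin (2 * k) ↪ Fin n ⊕ Fin N :=
    ⟨Sum.map (Fin.castLE hkn) fun x => ⟨o + x, by omega⟩,
      Function.Injective.sumMap (Fin.castLE_injective hkn) fun x y h => by
        simpa [Fin.ext_iff] using h⟩
  have hT : ∀ S, ∀ i ≤ 2 * k, symmDiff ((U univ).disjSum (first d₀))
      ((toggleSet k e S i).map ι) = (U S).disjSum (first (o + i)) := fun S i hi => by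
    ext (v | y)
    · have h1 : Sum.inl v ∈ (toggleSet k e S i).map ι ↔ ∃ s ∉ S, Fin.castLE hkn s = v := by
        simp [toggleSet, ι]
      have h2 : v ∈ U univ ↔ ∀ s : Fin k, Fin.castLE hkn s ≠ v := by simp [U]
      have h3 : v ∈ U S ↔ ∀ s ∈ S, Fin.castLE hkn s ≠ v := by simp [U]
      rw [mem_symmDiff, inl_mem_disjSum, inl_mem_disjSum, h1, h2, h3]
      by_cases hv : ∃ s, Fin.castLE hkn s = v
      · obtain ⟨s, rfl⟩ := hv
        simp
      · push Not at hv
        simp [hv]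
    · have h1 : Sum.inr y ∈ (toggleSet k e S i).map ι ↔
          ∃ x : Fin (2 * k), ((x : ℕ) < e ∧ ¬ (x : ℕ) < i ∨ (x : ℕ) < i ∧ ¬ (x : ℕ) < e) ∧
            o + (x : ℕ) = y := by
        simp [toggleSet, ι, mem_symmDiff, Fin.ext_iff]
      rw [mem_symmDiff, inr_mem_disjSum, inr_mem_disjSum, h1]
      simp only [first, mem_filter, mem_univ, true_and]
      have h2 : (∃ x : Fin (2 * k), ((x : ℕ) < e ∧ ¬ (x : ℕ) < i ∨ (x : ℕ) < i ∧ ¬ (x : ℕ) < e) ∧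
            o + (x : ℕ) = y) ↔ o ≤ (y : ℕ) ∧ ((y : ℕ) - o < e ∧ ¬ (y : ℕ) - o < i ∨
              (y : ℕ) - o < i ∧ ¬ (y : ℕ) - o < e) := by
        constructor
        · rintro ⟨x, hx, hy⟩
          omega
        · rintro ⟨h3, h4⟩
          exact ⟨⟨y - o, by omega⟩, h4, by simp only; omega⟩
      rw [h2]
      clear h1 h2
      omega
  refine ⟨(⟨e, hek⟩, univ.filter fun T => PrincipalNonsing (P.submatrix ι ι) T),
    ⟨P.submatrix ι ι, by simp⟩, fun S => #(U S) - 2 * ν S - o, fun S => ?_, fun S => ?_,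
    fun S i hi => ?_⟩
  · have := hanti S univ (subset_univ S)
    have := hU S
    have := hlow S
    simp only
    omega
  · have h1 := hanti ∅ S (empty_subset S)
    have h2 := hU S
    have h3 := hU ∅
    have h4 := hlow S
    have h5 := hlow ∅
    have h6 := hcard S
    have h7 := hcard ∅
    rw [card_empty] at h3 h5
    change 2 * (matchingNumber G - ν S) + _ = _
    rw [hνG]
    simp only
    omega
  · have h2 := hU S
    have h4 := hlow S
    have h6 := hcard S
    have hSk := card_le_univ S
    rw [Fintype.card_fin] at hSk
    rw [mem_filter, ← principalNonsing_map, ← hP, hT S i hi, hWA S (o + i) (by omega)]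
    simp only [mem_univ, true_and, Nat.even_iff]
    omega

theorem ncard_nonsingPatterns_le_two_pow (k : ℕ) :
    (nonsingPatterns (Fin k ⊕ Fin (2 * k))).ncard ≤ 2 ^ (54 * k ^ 3) := by
  have hR : Fintype.card (Fin k ⊕ Fin (2 * k)) = 3 * k := by
    rw [Fintype.card_sum, Fintype.card_fin, Fintype.card_fin]; ring
  have h := ncard_nonsingPatterns_le (Fin k ⊕ Fin (2 * k))
  rw [hR] at h
  refine h.trans ?_
  have h1 : 2 ^ (3 * k) * (3 * k) + 1 ≤ 2 ^ (6 * k) := by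
    have h2 : 3 * k + 1 ≤ 2 ^ (3 * k) := Nat.lt_two_pow_self
    have h3 : 1 ≤ 2 ^ (3 * k) := Nat.one_le_two_pow
    calc 2 ^ (3 * k) * (3 * k) + 1 ≤ 2 ^ (3 * k) * (3 * k + 1) := by rw [mul_add]; omega
      _ ≤ 2 ^ (3 * k) * 2 ^ (3 * k) := Nat.mul_le_mul_left _ h2
      _ = 2 ^ (6 * k) := by rw [← pow_add]; congr 1; ring
  calc _ ≤ (2 ^ (6 * k)) ^ (3 * k * (3 * k)) := Nat.pow_le_pow_left h1 _
    _ = 2 ^ (54 * k ^ 3) := by rw [← pow_mul]; congr 1; ring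

end Counting

/-- There is an absolute constant `c > 0` such that for every positive integer `k`,
the number of distinct functions `g_{G,k} : 2^{[k]} → {0,…,k}` (where
`g_{G,k}(S) = ν(G) − ν(G − S)`), taken over all finite simple graphs `G` whose vertex
set contains `{1,…,k}`, is at most `2^(c·k³)`. -/
theorem count_matching_defect_functions :
    ∃ c : ℕ, 0 < c ∧ ∀ k : ℕ, 0 < k →
      {g : Finset (Fin k) → ℕ |
          ∃ (n : ℕ) (hkn : k ≤ n) (G : SimpleGraph (Fin n)),
            g = fun S : Finset (Fin k) =>
              matchingNumber G -
                matchingNumber (G.induce {v : Fin n | v ∉ S.image (Fin.castLE hkn)})}.encard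
        ≤ ((2 ^ (c * k ^ 3) : ℕ) : ℕ∞) := by
  refine ⟨55, by norm_num, fun k hk => ?_⟩
  have hex : ∀ g ∈ {g : Finset (Fin k) → ℕ |
      ∃ (n : ℕ) (hkn : k ≤ n) (G : SimpleGraph (Fin n)),
        g = fun S : Finset (Fin k) =>
          matchingNumber G -
            matchingNumber (G.induce {v : Fin n | v ∉ S.image (Fin.castLE hkn)})},
      ∃ q : Fin (k + 1) × Finset (Finset (Fin k ⊕ Fin (2 * k))),
        q.2 ∈ nonsingPatterns _ ∧ Encodes q g := by
    rintro g ⟨n, hkn, G, rfl⟩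
    exact exists_encodes hkn G
  choose! q hq hqg using hex
  refine (Set.encard_le_encard_of_injOn
    (t := (Set.univ : Set (Fin (k + 1))) ×ˢ nonsingPatterns (Fin k ⊕ Fin (2 * k)))
    (fun g hg => ⟨trivial, hq g hg⟩)
    (fun g hg g' hg' h => (hqg g hg).unique (h ▸ hqg g' hg'))).trans ?_
  rw [← (Set.toFinite _).cast_ncard_eq, Nat.cast_le, Set.ncard_prod, Set.ncard_univ, Nat.card_fin]
  have hk3 : k ≤ k ^ 3 := Nat.le_self_pow (by norm_num) k
  calc (k + 1) * (nonsingPatterns (Fin k ⊕ Fin (2 * k))).ncard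
      ≤ 2 ^ k * 2 ^ (54 * k ^ 3) :=
        Nat.mul_le_mul Nat.lt_two_pow_self (ncard_nonsingPatterns_le_two_pow k)
    _ = 2 ^ (k + 54 * k ^ 3) := (pow_add _ _ _).symm
    _ ≤ 2 ^ (55 * k ^ 3) := Nat.pow_le_pow_right (by norm_num) (by omega)
end

section
/- There exists an absolute constant c > 0 with the following property. For all positive integers k and n, the number of distinct functions of the form f_{G,k}, taken over all finite simple graphs G on n vertices whose vertex set contains {1,…,k}, is at most n · 2^{c·k³}. -/
section ZeroPatterns

open MvPolynomial

/-- The monomials of individual degrees at most `N` span a space of dimension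
`(N + 1) ^ |σ|`. -/
theorem finrank_restrictDegree_le {σ F : Type*} [Fintype σ] [Field F] (N : ℕ) :
    Module.finrank F (restrictDegree σ F N) ≤ (N + 1) ^ Fintype.card σ := by
  classical
  have h := Module.finrank_eq_nat_card_basis
    (basisRestrictSupport F {n : σ →₀ ℕ | ∀ i, n i ≤ N})
  rw [restrictDegree, h]
  let g : {n : σ →₀ ℕ | ∀ i, n i ≤ N} → (σ → Fin (N + 1)) :=
    fun n i => ⟨n.1 i, Nat.lt_succ_of_le (n.2 i)⟩
  have hg : Function.Injective g := by
    intro a b hab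
    ext i
    exact congrArg Fin.val (congrFun hab i)
  simpa using Nat.card_le_card_of_injective g hg

/-- Rónyai–Babai–Ganapathy: a bound for the number of zero patterns of a finite family of
polynomials. -/
theorem ncard_range_zeroPattern_le {σ ι F : Type*} [Fintype σ] [Fintype ι] [Field F]
    (p : ι → MvPolynomial σ F) (D : ℕ) (hp : ∀ i, (p i).totalDegree ≤ D) :
    (Set.range fun x : σ → F => {i | eval x (p i) ≠ 0}).ncard
      ≤ (Fintype.card ι * D + 1) ^ Fintype.card σ := by
  classical
  set R := Set.range fun x : σ → F => {i | eval x (p i) ≠ 0}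
  have : Fintype R := Fintype.ofFinite R
  choose u hu using fun Z : R => Z.2
  let g : R → MvPolynomial σ F := fun Z => ∏ i ∈ Z.1.toFinset, p i
  have hg : ∀ S T : R, eval (u T) (g S) ≠ 0 ↔ S ≤ T := by
    intro S T
    have hT : ∀ i, i ∈ T.1 ↔ eval (u T) (p i) ≠ 0 := by
      intro i
      rw [← hu T]; rfl
    simp only [g, map_prod, Finset.prod_ne_zero_iff, Set.mem_toFinset, ← hT]
    rfl
  have hmem : ∀ S, g S ∈ restrictDegree σ F (Fintype.card ι * D) := by
    intro S
    apply restrictTotalDegree_le_restrictDegree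
    rw [mem_restrictTotalDegree]
    calc (g S).totalDegree ≤ ∑ i ∈ S.1.toFinset, (p i).totalDegree :=
          totalDegree_finsetProd _ _
      _ ≤ S.1.toFinset.card * D := Finset.sum_le_card_nsmul _ _ _ fun i _ => hp i
      _ ≤ _ := Nat.mul_le_mul_right _ (Finset.card_le_univ _)
  have hind : LinearIndependent F
      (fun S => (⟨g S, hmem S⟩ : restrictDegree σ F (Fintype.card ι * D))) := by
    rw [Fintype.linearIndependent_iff]
    intro c hc
    by_contra! hne
    have hc' : ∑ S, c S • g S = 0 := by
      simpa using congrArg Subtype.val hc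
    obtain ⟨S, hS, hmin⟩ := (Set.toFinite {S : R | c S ≠ 0}).exists_minimal hne
    have h := congrArg (eval (u S)) hc'
    rw [map_sum, Finset.sum_eq_single S] at h
    · simp only [smul_eval, map_zero, mul_eq_zero] at h
      exact h.elim hS ((hg S S).2 le_rfl)
    · intro T _ hTS
      by_contra hT
      simp only [smul_eval, mul_eq_zero, not_or] at hT
      have hle := (hg T S).1 hT.2
      exact hTS (le_antisymm hle (hmin hT.1 hle))
    · simp
  rw [Set.ncard_eq_toFinset_card', Set.toFinset_card]
  exact hind.fintype_card_le_finrank.trans (finrank_restrictDegree_le _)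

/-- The number of patterns of nonvanishing principal minors of matrices over a field. -/
theorem ncard_range_principalMinors_le {τ F : Type*} [Fintype τ] [DecidableEq τ] [Field F] :
    (Set.range fun B : Matrix τ τ F =>
        {J : Finset τ | (B.submatrix (Subtype.val : J → τ) Subtype.val).det ≠ 0}).ncard
      ≤ (2 ^ Fintype.card τ * Fintype.card τ + 1) ^ (Fintype.card τ ^ 2) := by
  let p : Finset τ → MvPolynomial (τ × τ) F := fun J =>
    ((Matrix.mvPolynomialX τ τ F).submatrix (Subtype.val : J → τ) Subtype.val).det
  have hp : ∀ J, (p J).totalDegree ≤ Fintype.card τ := by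
    intro J
    simp only [p, Matrix.det_apply]
    refine totalDegree_finsetSum_le fun s _ => ?_
    refine (totalDegree_smul_le _ _).trans ?_
    refine (totalDegree_finsetProd _ _).trans ?_
    simp only [Matrix.submatrix_apply, Matrix.mvPolynomialX_apply, totalDegree_X]
    simpa using Finset.card_le_univ J
  have h := ncard_range_zeroPattern_le p _ hp
  rw [Fintype.card_finset, Fintype.card_prod, ← sq] at h
  refine le_trans (Set.ncard_le_ncard ?_ (Set.toFinite _)) h
  rintro _ ⟨B, rfl⟩
  refine ⟨fun ij => B ij.1 ij.2, ?_⟩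
  ext J
  simp only [p, Set.mem_ofPred_eq, RingHom.map_det]
  have : (eval fun ij : τ × τ => B ij.1 ij.2).mapMatrix
      ((Matrix.mvPolynomialX τ τ F).submatrix (Subtype.val : J → τ) Subtype.val)
      = B.submatrix (Subtype.val : J → τ) Subtype.val := by
    ext i j
    simp
  rw [this]

end ZeroPatterns

section TutteMatrix

open MvPolynomial Matrix

/-- The generic symmetric matrix over `𝔽₂` supported on a relation. -/
noncomputable def genericSymm {V : Type*} (r : V → V → Prop) [DecidableRel r] :
    Matrix V V (MvPolynomial (Sym2 V) (ZMod 2)) :=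
  Matrix.of fun i j => if r i j then X s(i, j) else 0

/-- Jacobi's complementary minor formula for principal minors. -/
theorem det_submatrix_eq_det_mul_det_inv_submatrix {V U P F : Type*} [Fintype V] [DecidableEq V]
    [Fintype U] [DecidableEq U] [Fintype P] [DecidableEq P] [Field F]
    (A : Matrix V V F) (hA : A.det ≠ 0) (f : U → V) (g : P → V)
    (hfg : Function.Bijective (Sum.elim f g)) :
    (A.submatrix f f).det = A.det * (A⁻¹.submatrix g g).det := by
  let e : U ⊕ P ≃ V := Equiv.ofBijective _ hfg
  have hdet : (A.submatrix e e).det = A.det := det_submatrix_equiv_self e A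
  have hmul : A.submatrix e e * A⁻¹.submatrix e e = 1 := by
    rw [submatrix_mul_equiv, mul_nonsing_inv _ (isUnit_iff_ne_zero.2 hA), submatrix_one_equiv]
  have hA' : A.submatrix e e = fromBlocks (A.submatrix f f) (A.submatrix f g)
      (A.submatrix g f) (A.submatrix g g) := by
    ext (i | i) (j | j) <;> rfl
  have hB' : A⁻¹.submatrix e e = fromBlocks (A⁻¹.submatrix f f) (A⁻¹.submatrix f g)
      (A⁻¹.submatrix g f) (A⁻¹.submatrix g g) := by
    ext (i | i) (j | j) <;> rfl
  rw [hA', hB', fromBlocks_multiply, ← fromBlocks_one, fromBlocks_inj] at hmul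
  obtain ⟨-, h₁₂, -, h₂₂⟩ := hmul
  have key : fromBlocks (A.submatrix f f) (A.submatrix f g) (A.submatrix g f) (A.submatrix g g) *
      fromBlocks 1 (A⁻¹.submatrix f g) 0 (A⁻¹.submatrix g g) =
      fromBlocks (A.submatrix f f) 0 (A.submatrix g f) 1 := by
    rw [fromBlocks_multiply]
    simp [h₁₂, h₂₂]
  have := congrArg det key
  rw [det_mul, ← hA', hdet, det_fromBlocks_zero₂₁, det_fromBlocks_zero₁₂] at this
  simpa using this.symm

/-- A principal minor of the generic symmetric matrix supported on `r` is nonzero if and only if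
there is an involution supported on `r`. -/
theorem det_genericSymm_submatrix_ne_zero_iff {V U : Type*} [Fintype U] [DecidableEq U]
    (r : V → V → Prop) [DecidableRel r] (hr : ∀ i j, r i j → r j i) (f : U → V)
    (hf : Function.Injective f) :
    ((genericSymm r).submatrix f f).det ≠ 0 ↔
      ∃ s : U → U, Function.Involutive s ∧ ∀ i, r (f i) (f (s i)) := by
  classical
  have hsymm : ∀ i j, genericSymm r i j = genericSymm r j i := by
    intro i j
    have : r i j ↔ r j i := ⟨hr i j, hr j i⟩
    simp [genericSymm, this, Sym2.eq_swap]
  constructor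
  · intro h
    by_contra! hcon
    apply h
    rw [det_apply]
    refine Finset.sum_involution (fun s _ => s⁻¹) ?_ ?_ (by simp) (by simp)
    · intro s _
      have : ∏ i, (genericSymm r).submatrix f f (s⁻¹ i) i =
          ∏ i, (genericSymm r).submatrix f f (s i) i := by
        rw [← Equiv.prod_comp s]
        refine Finset.prod_congr rfl fun i _ => ?_
        simp [hsymm (f i)]
      rw [this, Equiv.Perm.sign_inv]
      exact CharTwo.add_self_eq_zero _
    · intro s _ hs heq
      have hinv : Function.Involutive s := by
        intro i
        exact DFunLike.congr_fun (mul_eq_one_iff_eq_inv.2 heq.symm) i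
      obtain ⟨i, hi⟩ := hcon s hinv
      apply hs
      rw [Finset.prod_eq_zero (Finset.mem_univ i), smul_zero]
      have : ¬ r (f (s i)) (f i) := fun h => hi (hr _ _ h)
      simp [genericSymm, this]
  · rintro ⟨s, hs, hrs⟩ h0
    let φ : Sym2 V → ZMod 2 := fun e => if ∃ i, e = s(f i, f (s i)) then 1 else 0
    have h := congrArg (eval φ) h0
    rw [RingHom.map_det, map_zero] at h
    have hP : (eval φ).mapMatrix ((genericSymm r).submatrix f f) =
        (hs.toPerm s).permMatrix (ZMod 2) := by
      ext i j
      have hiff : (∃ l, s(f i, f j) = s(f l, f (s l))) ↔ s i = j := by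
        constructor
        · rintro ⟨l, hl⟩
          rw [Sym2.eq_iff] at hl
          rcases hl with ⟨h1, h2⟩ | ⟨h1, h2⟩
          · rw [hf h1, hf h2]
          · rw [hf h1, hf h2, hs]
        · rintro rfl
          exact ⟨i, rfl⟩
      have hφ : φ s(f i, f j) = if s i = j then 1 else 0 := by
        simp only [φ, hiff]
      simp only [RingHom.mapMatrix_apply, map_apply, submatrix_apply, genericSymm, of_apply]
      rw [Equiv.Perm.permMatrix, PEquiv.toMatrix_apply]
      simp only [Equiv.toPEquiv_apply, Option.mem_def, Option.some.injEq, Function.Involutive.coe_toPerm]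
      by_cases hij : s i = j
      · have : r (f i) (f j) := hij ▸ hrs i
        simp [this, hij, hφ]
      · split_ifs <;> simp [hφ, hij]
    rw [hP, det_permutation] at h
    rcases Int.units_eq_one_or (Equiv.Perm.sign (hs.toPerm s)) with h1 | h1 <;> simp [h1] at h

end TutteMatrix

section MatchingNumber

variable {V : Type} [Fintype V]

theorem SimpleGraph.Subgraph.IsMatching.two_mul_ncard_edgeSet {G : SimpleGraph V}
    {M : G.Subgraph} (hM : M.IsMatching) : 2 * M.edgeSet.ncard = M.verts.ncard := by
  classical
  have h := M.spanningCoe.sum_degrees_eq_twice_card_edges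
  rw [← Set.ncard_coe_finset, SimpleGraph.coe_edgeFinset,
    SimpleGraph.Subgraph.edgeSet_spanningCoe] at h
  rw [← h, Set.ncard_eq_toFinset_card', Finset.card_eq_sum_ones,
    ← Finset.sum_subset (Finset.subset_univ M.verts.toFinset)]
  · refine Finset.sum_congr rfl fun v hv => ?_
    rw [SimpleGraph.Subgraph.degree_spanningCoe]
    exact (SimpleGraph.Subgraph.isMatching_iff_forall_degree.1 hM v (by simpa using hv))
  · intro v _ hv
    rw [SimpleGraph.Subgraph.degree_spanningCoe]
    exact SimpleGraph.Subgraph.degree_of_notMem_verts (by simpa using hv)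

theorem bddAbove_matching_sizes (G : SimpleGraph V) :
    BddAbove {n : ℕ | ∃ M : G.Subgraph, M.IsMatching ∧ M.edgeSet.ncard = n} := by
  refine ⟨Fintype.card V, ?_⟩
  rintro _ ⟨M, hM, rfl⟩
  have h := hM.two_mul_ncard_edgeSet
  have := Set.ncard_le_card M.verts
  rw [Nat.card_eq_fintype_card] at this
  omega

/-- An involution moving vertices along edges moves at most `2 ν(G)` vertices. -/
theorem ncard_moved_le_two_mul_matchingNumber (G : SimpleGraph V) {s : V → V}
    (hs : Function.Involutive s) (hadj : ∀ v, s v ≠ v → G.Adj v (s v)) :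
    {v | s v ≠ v}.ncard ≤ 2 * matchingNumber G := by
  let M : G.Subgraph :=
    { verts := {v | s v ≠ v}
      Adj := fun v w => s v ≠ v ∧ s v = w
      adj_sub := by
        rintro v _ ⟨hv, rfl⟩
        exact hadj v hv
      edge_vert := fun h => h.1
      symm := ⟨by
        rintro v _ ⟨hv, rfl⟩
        exact ⟨by rw [hs]; exact hv.symm, hs v⟩⟩ }
  have hM : M.IsMatching := fun v hv => ⟨s v, ⟨hv, rfl⟩, fun w hw => hw.2.symm⟩
  have h := hM.two_mul_ncard_edgeSet
  have hle : M.edgeSet.ncard ≤ matchingNumber G :=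
    le_csSup (bddAbove_matching_sizes G) ⟨M, hM, rfl⟩
  change 2 * _ = {v | s v ≠ v}.ncard at h
  omega

/-- A maximum matching yields an involution moving exactly `2 ν(G)` vertices along edges. -/
theorem exists_involutive_ncard_moved_eq (G : SimpleGraph V) :
    ∃ s : V → V, Function.Involutive s ∧ (∀ v, s v ≠ v → G.Adj v (s v)) ∧
      {v | s v ≠ v}.ncard = 2 * matchingNumber G := by
  classical
  obtain ⟨M, hM, hcard⟩ := Nat.sSup_mem
    (s := {n : ℕ | ∃ M : G.Subgraph, M.IsMatching ∧ M.edgeSet.ncard = n})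
    ⟨0, ⊥, fun v hv => by simp at hv, by simp⟩ (bddAbove_matching_sizes G)
  change _ = matchingNumber G at hcard
  choose p hp using fun v : M.verts => (hM v.2).exists
  let s : V → V := fun v => if hv : v ∈ M.verts then p ⟨v, hv⟩ else v
  have hs : ∀ v ∈ M.verts, M.Adj v (s v) := by
    intro v hv
    simp only [s, hv, dif_pos]
    exact hp ⟨v, hv⟩
  have hs' : ∀ v ∉ M.verts, s v = v := fun v hv => by simp [s, hv]
  have hmoved : {v | s v ≠ v} = M.verts := by
    ext v
    refine ⟨fun hv => by_contra fun h => hv (hs' v h), fun hv => (hs v hv).ne.symm⟩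
  refine ⟨s, fun v => ?_, fun v hv => ?_, ?_⟩
  · by_cases hv : v ∈ M.verts
    · exact hM.eq_of_adj_left (hs _ (hs v hv).snd_mem) (hs v hv).symm
    · rw [hs' v hv, hs' v hv]
  · exact (hs v (hmoved ▸ hv)).adj_sub
  · rw [hmoved, ← hcard, hM.two_mul_ncard_edgeSet]

theorem two_mul_matchingNumber_le_card (G : SimpleGraph V) :
    2 * matchingNumber G ≤ Fintype.card V := by
  obtain ⟨s, -, -, h⟩ := exists_involutive_ncard_moved_eq G
  rw [← h, ← Nat.card_eq_fintype_card]
  exact Set.ncard_le_card _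

theorem matchingNumber_induce_le (G : SimpleGraph V) (T : Set V) :
    matchingNumber (G.induce T) ≤ matchingNumber G := by
  classical
  obtain ⟨s, hs, hadj, h⟩ := exists_involutive_ncard_moved_eq (G.induce T)
  let t : V → V := fun v => if hv : v ∈ T then s ⟨v, hv⟩ else v
  have ht : ∀ v : T, t v = s v := fun v => by simp [t]
  have ht' : ∀ v ∉ T, t v = v := fun v hv => by simp [t, hv]
  have hle := ncard_moved_le_two_mul_matchingNumber G (s := t) (fun v => ?_) (fun v hv => ?_)
  · have himage : Subtype.val '' {v | s v ≠ v} ⊆ {v | t v ≠ v} := by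
      rintro _ ⟨v, hv, rfl⟩
      simpa [ht, Subtype.ext_iff] using hv
    have := Set.ncard_le_ncard himage (Set.toFinite _)
    rw [Set.ncard_image_of_injective _ Subtype.val_injective, h] at this
    omega
  · by_cases hv : v ∈ T
    · rw [ht ⟨v, hv⟩, ht, hs]
    · rw [ht' v hv, ht' v hv]
  · have hvT : v ∈ T := by_contra fun h => hv (ht' v h)
    rw [ht ⟨v, hvT⟩] at hv ⊢
    exact hadj ⟨v, hvT⟩ fun h => hv (congrArg Subtype.val h)

theorem matchingNumber_le_induce_add (G : SimpleGraph V) (T : Set V) :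
    matchingNumber G ≤ matchingNumber (G.induce T) + Tᶜ.ncard := by
  classical
  obtain ⟨s, hs, hadj, h⟩ := exists_involutive_ncard_moved_eq G
  let t : T → T := fun v => if hv : s v ∈ T then ⟨s v, hv⟩ else v
  have ht : ∀ v : T, s v ∈ T → (t v : V) = s v := fun v hv => by simp [t, hv]
  have ht' : ∀ v : T, s v ∉ T → t v = v := fun v hv => by simp [t, hv]
  have hle := ncard_moved_le_two_mul_matchingNumber (G.induce T) (s := t)
    (fun v => ?_) (fun v hv => ?_)
  · set A : Set T := {v | t v ≠ v}
    have hsub : {v | s v ≠ v} ⊆ Subtype.val '' A ∪ (Tᶜ ∪ s '' Tᶜ) := by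
      intro v hv
      by_cases hvT : v ∈ T
      · by_cases hsv : s v ∈ T
        · refine Or.inl ⟨⟨v, hvT⟩, fun h => hv ?_, rfl⟩
          rw [← ht ⟨v, hvT⟩ hsv, h]
        · exact Or.inr (Or.inr ⟨s v, hsv, hs v⟩)
      · exact Or.inr (Or.inl hvT)
    have h₁ := Set.ncard_le_ncard hsub (Set.toFinite _)
    have h₂ := Set.ncard_union_le (Subtype.val '' A) (Tᶜ ∪ s '' Tᶜ)
    have h₃ := Set.ncard_union_le Tᶜ (s '' Tᶜ)
    have h₄ := Set.ncard_image_le (f := s) (Set.toFinite Tᶜ)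
    rw [Set.ncard_image_of_injective _ Subtype.val_injective] at h₂
    omega
  · by_cases hv : s v ∈ T
    · apply Subtype.ext
      rw [ht _ (by rw [ht v hv, hs]; exact v.2), ht v hv, hs]
    · rw [ht' v hv, ht' v hv]
  · have hvT : s v ∈ T := by_contra fun h => hv (ht' v h)
    rw [SimpleGraph.comap_adj]
    change G.Adj v (t v)
    rw [ht v hvT]
    exact hadj v fun h => hv (Subtype.ext ((ht v hvT).trans h))

/-- Adjacency in the graph obtained from `G` by adding a set `D` of new vertices, each joined to
all vertices of `G` and carrying a loop. -/
def loopedJoinAdj {V D : Type} (G : SimpleGraph V) : V ⊕ D → V ⊕ D → Prop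
  | .inl v, .inl w => G.Adj v w
  | .inr d, .inr e => d = e
  | _, _ => True

theorem loopedJoinAdj_symm {V D : Type} (G : SimpleGraph V) (x y : V ⊕ D)
    (h : loopedJoinAdj G x y) : loopedJoinAdj G y x := by
  rcases x with v | d <;> rcases y with w | e
  · exact SimpleGraph.Adj.symm h
  · trivial
  · trivial
  · exact Eq.symm h

theorem exists_involutive_loopedJoinAdj_iff {D : Type} [Fintype D] (G : SimpleGraph V) :
    (∃ s : V ⊕ D → V ⊕ D, Function.Involutive s ∧ ∀ x, loopedJoinAdj G x (s x)) ↔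
      Fintype.card V ≤ 2 * matchingNumber G + Fintype.card D := by
  classical
  constructor
  · rintro ⟨s, hs, hr⟩
    let t : V → V := fun v => Sum.elim id (fun _ => v) (s (.inl v))
    have hl : ∀ v w, s (.inl v) = .inl w → t v = w := fun v w h => by simp [t, h]
    have hr' : ∀ v d, s (.inl v) = .inr d → t v = v := fun v w h => by simp [t, h]
    have hle := ncard_moved_le_two_mul_matchingNumber G (s := t) (fun v => ?_) (fun v hv => ?_)
    · have hfix : {v | t v ≠ v}ᶜ.ncard ≤ Fintype.card D := by
        rw [← Nat.card_eq_fintype_card, ← Set.ncard_univ,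
          ← Set.ncard_image_of_injective (Set.univ : Set D) (Sum.inr_injective (α := V)),
          ← Set.ncard_image_of_injective {v | t v ≠ v}ᶜ
            (hs.injective.comp (Sum.inl_injective (β := D)))]
        refine Set.ncard_le_ncard ?_ (Set.toFinite _)
        rintro _ ⟨v, hv, rfl⟩
        cases h : s (.inl v) with
        | inl w =>
          have hvw := hr (.inl v)
          rw [h] at hvw
          refine absurd ?_ hv
          change t v ≠ v
          rw [hl v w h]
          exact (G.ne_of_adj hvw).symm
        | inr d => exact ⟨d, trivial, h.symm⟩
      have := Set.ncard_add_ncard_compl {v | t v ≠ v}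
      rw [Nat.card_eq_fintype_card] at this
      omega
    · cases h : s (.inl v) with
      | inl w =>
        rw [hl v w h]
        exact hl w v (by rw [← h, hs])
      | inr d => rw [hr' v d h, hr' v d h]
    · cases h : s (.inl v) with
      | inl w =>
        have hvw := hr (.inl v)
        rw [h] at hvw
        rw [hl v w h]
        exact hvw
      | inr d => exact absurd (hr' v d h) hv
  · intro hle
    obtain ⟨s, hs, hadj, hcard⟩ := exists_involutive_ncard_moved_eq G
    have hF : Fintype.card {v // s v = v} ≤ Fintype.card D := by
      have h₁ := Set.ncard_add_ncard_compl {v | s v ≠ v}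
      have h₂ : {v | s v ≠ v}ᶜ = {v | s v = v} := by ext; simp
      have h₃ : {v | s v = v}.ncard = Fintype.card {v // s v = v} :=
        (Nat.card_eq_fintype_card (α := {v // s v = v})).symm ▸ rfl
      rw [Nat.card_eq_fintype_card, h₂, h₃] at h₁
      omega
    obtain ⟨e⟩ := Function.Embedding.nonempty_of_card_le hF
    let t : V ⊕ D → V ⊕ D := Sum.elim
      (fun v => if hv : s v = v then .inr (e ⟨v, hv⟩) else .inl (s v))
      (fun d => if hd : ∃ v, e v = d then .inl hd.choose.1 else .inr d)
    have h₁ : ∀ v (hv : s v = v), t (.inl v) = .inr (e ⟨v, hv⟩) := fun v hv => by simp [t, hv]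
    have h₂ : ∀ v, s v ≠ v → t (.inl v) = .inl (s v) := fun v hv => by simp [t, hv]
    have h₃ : ∀ v, t (.inr (e v)) = .inl v.1 := by
      intro v
      have hd : ∃ w, e w = e v := ⟨v, rfl⟩
      have : hd.choose = v := e.injective hd.choose_spec
      simp only [t, Sum.elim_inr, dif_pos hd, this]
    have h₄ : ∀ d, (¬ ∃ v, e v = d) → t (.inr d) = .inr d := fun d hd => by
      simp only [t, Sum.elim_inr, dif_neg hd]
    refine ⟨t, ?_, ?_⟩
    · rintro (v | d)
      · by_cases hv : s v = v
        · rw [h₁ v hv, h₃]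
        · rw [h₂ v hv, h₂ _ (by rw [hs]; exact Ne.symm hv), hs]
      · by_cases hd : ∃ v, e v = d
        · obtain ⟨v, rfl⟩ := hd
          rw [h₃, h₁ _ v.2]
        · rw [h₄ d hd, h₄ d hd]
    · rintro (v | d)
      · by_cases hv : s v = v
        · rw [h₁ v hv]
          trivial
        · rw [h₂ v hv]
          exact hadj v hv
      · by_cases hd : ∃ v, e v = d
        · obtain ⟨v, rfl⟩ := hd
          rw [h₃]
          trivial
        · rw [h₄ d hd]
          rfl

end MatchingNumber

/-- If `G` has deficiency at most `|D|`, the matching numbers of the graphs obtained by deleting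
terminals are encoded in the principal minors of a matrix indexed by the terminals of `V` and `D`. -/
theorem exists_matrix_principalMinors_iff {V D P Q : Type} [Fintype V] [DecidableEq V] [Fintype D]
    [DecidableEq P] [DecidableEq Q] (a : P ↪ V) (b : Q ↪ D) (G : SimpleGraph V)
    (hG : Fintype.card V ≤ 2 * matchingNumber G + Fintype.card D) :
    ∃ B : Matrix (P ⊕ Q) (P ⊕ Q) (FractionRing (MvPolynomial (Sym2 (V ⊕ D)) (ZMod 2))),
      ∀ (S : Finset P) (T : Finset Q),
        (B.submatrix (Subtype.val : S.disjSum T → P ⊕ Q) Subtype.val).det ≠ 0 ↔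
          Fintype.card V + T.card ≤
            2 * matchingNumber (G.induce {v | v ∉ S.image a}) + Fintype.card D + S.card := by
  classical
  let R := MvPolynomial (Sym2 (V ⊕ D)) (ZMod 2)
  let φ : R →+* FractionRing R := algebraMap R (FractionRing R)
  have hφ : Function.Injective φ := IsFractionRing.injective R (FractionRing R)
  let M : Matrix (V ⊕ D) (V ⊕ D) R := genericSymm (loopedJoinAdj G)
  let A := φ.mapMatrix M
  have hminor : ∀ {U : Type} [Fintype U] [DecidableEq U] (f : U → V ⊕ D),
      Function.Injective f → ((A.submatrix f f).det ≠ 0 ↔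
        ∃ s : U → U, Function.Involutive s ∧ ∀ i, loopedJoinAdj G (f i) (f (s i))) := by
    intro U _ _ f hf
    rw [← det_genericSymm_submatrix_ne_zero_iff (loopedJoinAdj G) (loopedJoinAdj_symm G) f hf]
    have : A.submatrix f f = φ.mapMatrix (M.submatrix f f) := rfl
    rw [this, ← RingHom.map_det, map_ne_zero_iff φ hφ]
  have hA : A.det ≠ 0 :=
    (hminor id Function.injective_id).2 ((exists_involutive_loopedJoinAdj_iff G).2 hG)
  let g : P ⊕ Q → V ⊕ D := Sum.map a b
  refine ⟨A⁻¹.submatrix g g, fun S T => ?_⟩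
  let f : {v // v ∉ S.image a} ⊕ {x // x ∉ T.image b} → V ⊕ D := Sum.map Subtype.val Subtype.val
  have hf : Function.Injective f := Subtype.val_injective.sumMap Subtype.val_injective
  have hg : Function.Injective g := a.injective.sumMap b.injective
  have hfg : Function.Bijective
      (Sum.elim f (g ∘ (Subtype.val : S.disjSum T → P ⊕ Q))) := by
    constructor
    · refine hf.sumElim (hg.comp Subtype.val_injective) ?_
      rintro (⟨v, hv⟩ | ⟨x, hx⟩) ⟨p | q, hpq⟩ h
      · simp only [Finset.inl_mem_disjSum] at hpq
        exact hv (Finset.mem_image.2 ⟨p, hpq, (Sum.inl_injective h).symm⟩)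
      · exact Sum.inl_ne_inr h
      · exact Sum.inr_ne_inl h
      · simp only [Finset.inr_mem_disjSum] at hpq
        exact hx (Finset.mem_image.2 ⟨q, hpq, (Sum.inr_injective h).symm⟩)
    · rintro (v | x)
      · by_cases hv : v ∈ S.image a
        · obtain ⟨p, hp, rfl⟩ := Finset.mem_image.1 hv
          exact ⟨.inr ⟨.inl p, Finset.inl_mem_disjSum.2 hp⟩, rfl⟩
        · exact ⟨.inl (.inl ⟨v, hv⟩), rfl⟩
      · by_cases hx : x ∈ T.image b
        · obtain ⟨q, hq, rfl⟩ := Finset.mem_image.1 hx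
          exact ⟨.inr ⟨.inr q, Finset.inr_mem_disjSum.2 hq⟩, rfl⟩
        · exact ⟨.inl (.inr ⟨x, hx⟩), rfl⟩
  have hdet := det_submatrix_eq_det_mul_det_inv_submatrix A hA f _ hfg
  have hiff : ((A⁻¹.submatrix g g).submatrix (Subtype.val : S.disjSum T → P ⊕ Q)
      Subtype.val).det ≠ 0 ↔ (A.submatrix f f).det ≠ 0 := by
    rw [hdet, Matrix.submatrix_submatrix, mul_ne_zero_iff]
    exact ⟨fun h => ⟨hA, h⟩, fun h => h.2⟩
  rw [hiff, hminor f hf]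
  have hadj : ∀ x y, loopedJoinAdj G (f x) (f y) ↔
      loopedJoinAdj (G.induce {v | v ∉ S.image a}) x y := by
    rintro (v | x) (w | y)
    · rfl
    · rfl
    · rfl
    · exact Subtype.ext_iff.symm
  simp only [hadj]
  have hV : Fintype.card {v // v ∉ S.image a} + S.card = Fintype.card V := by
    have := Fintype.card_subtype_compl (· ∈ S.image a)
    have hle := Finset.card_le_univ (S.image a)
    rw [Fintype.card_coe, Finset.card_image_of_injective _ a.injective] at this
    rw [Finset.card_image_of_injective _ a.injective] at hle
    omega
  have hD : Fintype.card {x // x ∉ T.image b} + T.card = Fintype.card D := by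
    have := Fintype.card_subtype_compl (· ∈ T.image b)
    have hle := Finset.card_le_univ (T.image b)
    rw [Fintype.card_coe, Finset.card_image_of_injective _ b.injective] at this
    rw [Finset.card_image_of_injective _ b.injective] at hle
    omega
  have h := exists_involutive_loopedJoinAdj_iff (D := {x // x ∉ T.image b})
    (G.induce {v | v ∉ S.image a})
  have hV' : Fintype.card ({v | v ∉ S.image a} : Set V) =
    Fintype.card {v // v ∉ S.image a} := Fintype.card_congr (Equiv.refl _)
  rw [hV'] at h
  refine h.trans ?_
  omega

/-- Graphs with a prescribed matching number have at most `2 ^ (54 * k ^ 3)` deletion functions. -/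
theorem encard_deletion_functions_of_matchingNumber_eq_le {k n : ℕ} (hk : 0 < k) (hkn : k ≤ n)
    (m : ℕ) :
    {f : Finset (Fin k) → ℕ | ∃ G : SimpleGraph (Fin n), matchingNumber G = m ∧
        f = fun S : Finset (Fin k) =>
          matchingNumber (G.induce {v : Fin n | v ∉ S.image (Fin.castLE hkn)})}.encard
      ≤ ((2 ^ (54 * k ^ 3) : ℕ) : ℕ∞) := by
  classical
  set d := n - 2 * m + k
  set l := min (2 * k) d
  let τ := Fin k ⊕ Fin l
  let F := FractionRing (MvPolynomial (Sym2 (Fin n ⊕ Fin d)) (ZMod 2))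
  let patterns := Set.range fun B : Matrix τ τ F =>
    {J : Finset τ | (B.submatrix (Subtype.val : J → τ) Subtype.val).det ≠ 0}
  have hB : ∀ G : SimpleGraph (Fin n), matchingNumber G = m → ∃ Z ∈ patterns,
      ∀ (S : Finset (Fin k)) (T : Finset (Fin l)),
      S.disjSum T ∈ Z ↔ n + T.card ≤ 2 * matchingNumber
        (G.induce {v : Fin n | v ∉ S.image (Fin.castLE hkn)}) + d + S.card := by
    intro G hG
    obtain ⟨B, hB⟩ := exists_matrix_principalMinors_iff (Fin.castLEEmb hkn)
      (Fin.castLEEmb (min_le_right (2 * k) d)) G (by simp only [Fintype.card_fin]; omega)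
    simp only [Fintype.card_fin] at hB
    exact ⟨_, ⟨B, rfl⟩, hB⟩
  have hcard : patterns.encard ≤ ((2 ^ (54 * k ^ 3) : ℕ) : ℕ∞) := by
    rw [← (Set.toFinite patterns).cast_ncard_eq, Nat.cast_le]
    refine (ncard_range_principalMinors_le (τ := τ) (F := F)).trans ?_
    have ht : Fintype.card τ ≤ 3 * k := by
      simp only [τ, Fintype.card_sum, Fintype.card_fin]
      omega
    have hbase : 2 ^ (3 * k) * (3 * k) + 1 ≤ 2 ^ (6 * k) := by
      have h₁ : 3 * k + 1 ≤ 2 ^ (3 * k) := Nat.lt_two_pow_self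
      have h₂ : 2 ^ (6 * k) = 2 ^ (3 * k) * 2 ^ (3 * k) := by rw [← pow_add]; ring_nf
      nlinarith
    calc (2 ^ Fintype.card τ * Fintype.card τ + 1) ^ (Fintype.card τ ^ 2)
        ≤ (2 ^ (3 * k) * (3 * k) + 1) ^ ((3 * k) ^ 2) := by
          refine (Nat.pow_le_pow_right (by omega) (Nat.pow_le_pow_left ht 2)).trans
            (Nat.pow_le_pow_left ?_ _)
          gcongr
          norm_num
      _ ≤ (2 ^ (6 * k)) ^ ((3 * k) ^ 2) := Nat.pow_le_pow_left hbase _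
      _ = 2 ^ (54 * k ^ 3) := by rw [← pow_mul]; ring_nf
  refine le_trans ?_ hcard
  choose! Z hZ hZiff using hB
  let graph : (Finset (Fin k) → ℕ) → SimpleGraph (Fin n) := fun f =>
    if h : ∃ G : SimpleGraph (Fin n), matchingNumber G = m ∧
      f = fun S : Finset (Fin k) =>
        matchingNumber (G.induce {v : Fin n | v ∉ S.image (Fin.castLE hkn)})
    then h.choose else ⊥
  have hgraph : ∀ f, (∃ G : SimpleGraph (Fin n), matchingNumber G = m ∧
      f = fun S : Finset (Fin k) =>
        matchingNumber (G.induce {v : Fin n | v ∉ S.image (Fin.castLE hkn)})) →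
      matchingNumber (graph f) = m ∧ f = fun S : Finset (Fin k) =>
        matchingNumber ((graph f).induce {v : Fin n | v ∉ S.image (Fin.castLE hkn)}) := by
    intro f h
    simp only [graph, dif_pos h]
    exact h.choose_spec
  refine Set.encard_le_encard_of_injOn (f := fun f => Z (graph f))
    (fun f hf => hZ _ (hgraph f hf).1) ?_
  have hnot_lt : ∀ G₁ G₂ : SimpleGraph (Fin n), matchingNumber G₁ = m → matchingNumber G₂ = m →
      Z G₁ = Z G₂ → ∀ S : Finset (Fin k),
      matchingNumber (G₂.induce {v : Fin n | v ∉ S.image (Fin.castLE hkn)}) ≤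
        matchingNumber (G₁.induce {v : Fin n | v ∉ S.image (Fin.castLE hkn)}) := by
    intro G₁ G₂ h₁ h₂ hZ₁₂ S
    by_contra! hlt
    have hS : ({v : Fin n | v ∉ S.image (Fin.castLE hkn)}ᶜ).ncard = S.card := by
      have : {v : Fin n | v ∉ S.image (Fin.castLE hkn)}ᶜ = ↑(S.image (Fin.castLE hkn)) := by
        ext; simp
      rw [this, Set.ncard_coe_finset,
        Finset.card_image_of_injective _ (Fin.castLE_injective hkn)]
    have hlow := matchingNumber_le_induce_add G₁ {v : Fin n | v ∉ S.image (Fin.castLE hkn)}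
    have hhigh := matchingNumber_induce_le G₂ {v : Fin n | v ∉ S.image (Fin.castLE hkn)}
    have htwo := two_mul_matchingNumber_le_card
      (G₂.induce {v : Fin n | v ∉ S.image (Fin.castLE hkn)})
    have hW : Fintype.card ({v : Fin n | v ∉ S.image (Fin.castLE hkn)} : Set (Fin n)) +
        S.card = n := by
      have := Set.ncard_add_ncard_compl {v : Fin n | v ∉ S.image (Fin.castLE hkn)}
      rw [hS, Nat.card_eq_fintype_card, Fintype.card_fin, ← Nat.card_coe_set_eq,
        Nat.card_eq_fintype_card] at this
      exact this
    have hG₂ := two_mul_matchingNumber_le_card G₂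
    rw [Fintype.card_fin] at hG₂
    have hSk : S.card ≤ k := by simpa using Finset.card_le_univ S
    rw [hS] at hlow
    obtain ⟨T, -, hT⟩ := Finset.exists_subset_card_eq (s := (Finset.univ : Finset (Fin l)))
      (n := 2 * matchingNumber (G₂.induce {v : Fin n | v ∉ S.image (Fin.castLE hkn)}) +
        d + S.card - n) (by rw [Finset.card_univ, Fintype.card_fin]; omega)
    have hiff₁ := hZiff G₁ h₁ S T
    have hiff₂ := hZiff G₂ h₂ S T
    rw [hZ₁₂, hiff₂] at hiff₁
    omega
  intro f₁ hf₁ f₂ hf₂ h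
  obtain ⟨h₁, e₁⟩ := hgraph f₁ hf₁
  obtain ⟨h₂, e₂⟩ := hgraph f₂ hf₂
  rw [e₁, e₂]
  funext S
  exact le_antisymm (hnot_lt _ _ h₂ h₁ h.symm S) (hnot_lt _ _ h₁ h₂ h S)

/-- There is an absolute constant `c > 0` such that for all positive integers `k` and
`n`, the number of distinct functions `f_{G,k} : 2^{[k]} → ℕ` (where
`f_{G,k}(S) = ν(G − S)`), taken over all finite simple graphs `G` on `n` vertices whose
vertex set contains `{1,…,k}`, is at most `n · 2^(c·k³)`. -/
theorem count_matching_number_deletion_functions :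
    ∃ c : ℕ, 0 < c ∧ ∀ k n : ℕ, 0 < k → 0 < n →
      {f : Finset (Fin k) → ℕ |
          ∃ (hkn : k ≤ n) (G : SimpleGraph (Fin n)),
            f = fun S : Finset (Fin k) =>
              matchingNumber (G.induce {v : Fin n | v ∉ S.image (Fin.castLE hkn)})}.encard
        ≤ ((n * 2 ^ (c * k ^ 3) : ℕ) : ℕ∞) := by
  classical
  refine ⟨55, by norm_num, fun k n hk hn => ?_⟩
  by_cases hkn : k ≤ n
  · calc _ ≤ (⋃ m ∈ Finset.range (n / 2 + 1), {f : Finset (Fin k) → ℕ |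
          ∃ G : SimpleGraph (Fin n), matchingNumber G = m ∧ f = fun S : Finset (Fin k) =>
            matchingNumber (G.induce {v : Fin n | v ∉ S.image (Fin.castLE hkn)})}).encard := by
          refine Set.encard_le_encard ?_
          rintro f ⟨_, G, hf⟩
          have h := two_mul_matchingNumber_le_card G
          rw [Fintype.card_fin] at h
          exact Set.mem_biUnion (x := matchingNumber G)
            (Finset.mem_coe.2 (Finset.mem_range.2 (by omega))) ⟨G, rfl, hf⟩
      _ ≤ ∑ m ∈ Finset.range (n / 2 + 1), ((2 ^ (54 * k ^ 3) : ℕ) : ℕ∞) :=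
          (Finset.set_encard_biUnion_le _ _).trans (Finset.sum_le_sum fun m _ =>
            encard_deletion_functions_of_matchingNumber_eq_le hk hkn m)
      _ = (((n / 2 + 1) * 2 ^ (54 * k ^ 3) : ℕ) : ℕ∞) := by
          rw [Finset.sum_const, Finset.card_range, nsmul_eq_mul, ← Nat.cast_mul]
      _ ≤ _ := by
          rw [Nat.cast_le]
          have h₁ : 1 < 2 ^ k ^ 3 := Nat.one_lt_two_pow (by positivity)
          have h₂ : 2 ^ (55 * k ^ 3) = 2 ^ k ^ 3 * 2 ^ (54 * k ^ 3) := by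
            rw [← pow_add]; ring_nf
          rw [h₂, ← mul_assoc]
          refine Nat.mul_le_mul_right _ ?_
          have : n * 2 ≤ n * 2 ^ k ^ 3 := Nat.mul_le_mul_left n h₁
          omega
  · refine (Set.encard_eq_zero.2 (Set.eq_empty_iff_forall_notMem.2 ?_)).trans_le zero_le
    rintro f ⟨h, -⟩
    exact hkn h
end
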